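/- arXiv:2101.02730 — 2 statements merged into one kernel-verified Lean document; each statement's English description precedes it below -/
import Mathlib

section
/- Let N be a positive natural number, let A be a real symmetric N×N matrix, and let M be a natural number with 1 ≤ M ≤ N. For a real number α, define the constraint matrix C(α) = α (J_N − 2M I_N), where J_N is the N×N all-ones matrix and I_N the N×N identity matrix. Then there exists a real number α₀ ≥ 0 such that for every α > α₀, every binary vector x ∈ {0,1}^N that minimizes the quadratic form xᵀ (A + C(α)) x over all binary vectors in {0,1}^N satisfies ∑_i x_i = M. -/
open Matrix

/-- The all-ones matrix minus `c • 1` evaluates on a binary vector to a function of its sum. -/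
theorem binary_quadForm_constraint {ι : Type*} [Fintype ι] [DecidableEq ι] (c : ℝ) {x : ι → ℝ}
    (hx : ∀ i, x i = 0 ∨ x i = 1) :
    x ⬝ᵥ ((Matrix.of fun _ _ : ι => (1 : ℝ)) - c • (1 : Matrix ι ι ℝ)).mulVec x
      = (∑ i, x i) ^ 2 - c * ∑ i, x i := by
  have hJ : (Matrix.of fun _ _ : ι => (1 : ℝ)).mulVec x = fun _ => ∑ i, x i := by
    ext i
    simp [Matrix.mulVec, dotProduct]
  have hsq : x ⬝ᵥ x = ∑ i, x i :=
    Finset.sum_congr rfl fun i _ => by rcases hx i with h | h <;> simp [h]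
  rw [Matrix.sub_mulVec, dotProduct_sub, Matrix.smul_mulVec, Matrix.one_mulVec,
    dotProduct_smul, hsq, hJ, smul_eq_mul]
  simp only [dotProduct, ← Finset.sum_mul]
  ring

theorem abs_binary_quadForm_le {ι : Type*} [Fintype ι] (A : Matrix ι ι ℝ) {x : ι → ℝ}
    (hx : ∀ i, x i = 0 ∨ x i = 1) :
    |x ⬝ᵥ A.mulVec x| ≤ ∑ i, ∑ j, |A i j| := by
  simp only [dotProduct, Matrix.mulVec, Finset.mul_sum]
  refine (Finset.abs_sum_le_sum_abs _ _).trans (Finset.sum_le_sum fun i _ => ?_)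
  refine (Finset.abs_sum_le_sum_abs _ _).trans (Finset.sum_le_sum fun j _ => ?_)
  rcases hx i with hi | hi <;> rcases hx j with hj | hj <;> simp [hi, hj]

theorem exists_natCast_eq_sum_binary {ι : Type*} [Fintype ι] {x : ι → ℝ}
    (hx : ∀ i, x i = 0 ∨ x i = 1) : ∃ n : ℕ, ∑ i, x i = n := by
  classical
  refine ⟨(Finset.univ.filter fun i => x i = 1).card, ?_⟩
  rw [← Finset.sum_boole]
  exact Finset.sum_congr rfl fun i _ => by rcases hx i with h | h <;> simp [h]

theorem exists_binary_sum_eq {N M : ℕ} (hMN : M ≤ N) :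
    ∃ y : Fin N → ℝ, (∀ i, y i = 0 ∨ y i = 1) ∧ ∑ i, y i = M := by
  refine ⟨fun i => if (i : ℕ) < M then 1 else 0, fun i => ?_, ?_⟩
  · by_cases h : (i : ℕ) < M <;> simp [h]
  · rw [Finset.sum_boole, Fin.card_filter_val_lt, min_eq_right hMN]

theorem one_le_sq_natCast_sub {m n : ℕ} (h : n ≠ m) : (1 : ℝ) ≤ ((n : ℝ) - m) ^ 2 := by
  have hz : (n : ℤ) - m ≠ 0 := sub_ne_zero.2 (by exact_mod_cast h)
  have hp : 0 < ((n : ℤ) - m) ^ 2 := by positivity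
  exact_mod_cast Int.add_one_le_iff.2 hp

theorem qubo_constraint_forces_size (N : ℕ) (hN : 0 < N)
    (A : Matrix (Fin N) (Fin N) ℝ) (hA : A.IsSymm)
    (M : ℕ) (hM1 : 1 ≤ M) (hMN : M ≤ N)
    (C : ℝ → Matrix (Fin N) (Fin N) ℝ)
    (hC : ∀ α, C α = α • ((Matrix.of fun _ _ : Fin N => (1 : ℝ))
        - (2 * (M : ℝ)) • (1 : Matrix (Fin N) (Fin N) ℝ))) :
    ∃ α₀ : ℝ, 0 ≤ α₀ ∧ ∀ α > α₀, ∀ x : Fin N → ℝ,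
      (∀ i, x i = 0 ∨ x i = 1) →
      (∀ y : Fin N → ℝ, (∀ i, y i = 0 ∨ y i = 1) →
        x ⬝ᵥ (A + C α).mulVec x ≤ y ⬝ᵥ (A + C α).mulVec y) →
      ∑ i, x i = (M : ℝ) := by
  have hK : 0 ≤ ∑ i, ∑ j, |A i j| :=
    Finset.sum_nonneg fun i _ => Finset.sum_nonneg fun j _ => abs_nonneg _
  refine ⟨2 * ∑ i, ∑ j, |A i j|, by positivity, fun α hα x hx hmin => ?_⟩
  obtain ⟨y, hy, hysum⟩ := exists_binary_sum_eq hMN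
  obtain ⟨n, hn⟩ := exists_natCast_eq_sum_binary hx
  have hxy := hmin y hy
  simp only [hC, Matrix.add_mulVec, dotProduct_add, Matrix.smul_mulVec, dotProduct_smul,
    smul_eq_mul] at hxy
  rw [binary_quadForm_constraint _ hx, binary_quadForm_constraint _ hy, hysum, hn] at hxy
  have hxA := neg_le_of_abs_le (abs_binary_quadForm_le A hx)
  have hyA := le_of_abs_le (abs_binary_quadForm_le A hy)
  rw [hn]
  by_contra hne
  have hsq : (1 : ℝ) ≤ ((n : ℝ) - M) ^ 2 := one_le_sq_natCast_sub fun h => hne (by rw [h])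
  have hα0 : 0 ≤ α := by linarith
  have hpen : α ≤ α * ((n : ℝ) - M) ^ 2 := le_mul_of_one_le_right hα0 hsq
  linarith
end

section
/- Let N be a positive natural number, let A be a real symmetric N×N matrix, let M be a natural number with 1 ≤ M ≤ N, and let C(α) = α (J_N − 2M I_N). Then there exists α₀ ≥ 0 such that for every α > α₀, the minimum of xᵀ (A + C(α)) x over all binary vectors x ∈ {0,1}^N equals (the minimum of xᵀ A x over all binary vectors x ∈ {0,1}^N with ∑_i x_i = M) minus α M². -/
open Matrix

/-- On binary vectors a quadratic form is bounded by the entrywise ℓ¹ norm of its matrix. -/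
theorem abs_dotProduct_mulVec_le_of_binary {n : Type*} [Fintype n] (A : Matrix n n ℝ)
    {x : n → ℝ} (hx : ∀ i, x i = 0 ∨ x i = 1) :
    |x ⬝ᵥ A.mulVec x| ≤ ∑ i, ∑ j, |A i j| := by
  have habs : ∀ i, |x i| ≤ 1 := fun i => by rcases hx i with h | h <;> simp [h]
  simp only [dotProduct, mulVec, Finset.mul_sum]
  refine (Finset.abs_sum_le_sum_abs _ _).trans (Finset.sum_le_sum fun i _ => ?_)
  refine (Finset.abs_sum_le_sum_abs _ _).trans (Finset.sum_le_sum fun j _ => ?_)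
  rw [abs_mul, abs_mul]
  calc |x i| * (|A i j| * |x j|) ≤ 1 * (|A i j| * 1) := by
        gcongr
        · exact habs i
        · exact habs j
    _ = |A i j| := by ring

theorem exists_nat_sum_eq_of_binary {n : Type*} [Fintype n] {x : n → ℝ}
    (hx : ∀ i, x i = 0 ∨ x i = 1) : ∃ k : ℕ, ∑ i, x i = k := by
  classical
  refine ⟨∑ i, if x i = 1 then 1 else 0, ?_⟩
  push_cast
  exact Finset.sum_congr rfl fun i _ => by rcases hx i with h | h <;> simp [h]

/-- Adding the penalty matrix `α (J - 2 c I)` completes a square on binary vectors. -/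
theorem dotProduct_add_penalty_mulVec_of_binary {n : Type*} [Fintype n] [DecidableEq n]
    (A : Matrix n n ℝ) (α c : ℝ) {x : n → ℝ} (hx : ∀ i, x i = 0 ∨ x i = 1) :
    x ⬝ᵥ (A + α • ((Matrix.of fun _ _ : n => (1 : ℝ)) - (2 * c) • (1 : Matrix n n ℝ))).mulVec x
      = x ⬝ᵥ A.mulVec x + α * (∑ i, x i - c) ^ 2 - α * c ^ 2 := by
  have hJ : x ⬝ᵥ (Matrix.of fun _ _ : n => (1 : ℝ)).mulVec x = (∑ i, x i) ^ 2 := by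
    simp [dotProduct, mulVec, ← Finset.sum_mul, sq]
  have hI : x ⬝ᵥ x = ∑ i, x i :=
    Finset.sum_congr rfl fun i _ => by rcases hx i with h | h <;> simp [h]
  rw [add_mulVec, smul_mulVec, sub_mulVec, smul_mulVec, one_mulVec, dotProduct_add,
    dotProduct_smul, dotProduct_sub, dotProduct_smul, hJ, hI, smul_eq_mul, smul_eq_mul]
  ring

theorem one_le_sq_natCast_sub_natCast {k m : ℕ} (h : k ≠ m) : (1 : ℝ) ≤ ((k : ℝ) - m) ^ 2 := by
  have hne : (k : ℤ) - m ≠ 0 := sub_ne_zero.mpr (by exact_mod_cast h)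
  have hpos : 0 < ((k : ℤ) - m) ^ 2 := by positivity
  exact_mod_cast hpos

theorem qubo_constrained_min_eq (N : ℕ) (hN : 0 < N)
    (A : Matrix (Fin N) (Fin N) ℝ) (hA : A.IsSymm)
    (M : ℕ) (hM1 : 1 ≤ M) (hMN : M ≤ N)
    (C : ℝ → Matrix (Fin N) (Fin N) ℝ)
    (hC : ∀ α, C α = α • ((Matrix.of fun _ _ : Fin N => (1 : ℝ))
        - (2 * (M : ℝ)) • (1 : Matrix (Fin N) (Fin N) ℝ))) :
    ∃ α₀ : ℝ, 0 ≤ α₀ ∧ ∀ α > α₀, ∀ m₁ m₂ : ℝ,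
      IsLeast {v : ℝ | ∃ x : Fin N → ℝ, (∀ i, x i = 0 ∨ x i = 1) ∧
          v = x ⬝ᵥ (A + C α).mulVec x} m₁ →
      IsLeast {v : ℝ | ∃ x : Fin N → ℝ, (∀ i, x i = 0 ∨ x i = 1) ∧
          (∑ i, x i = (M : ℝ)) ∧ v = x ⬝ᵥ A.mulVec x} m₂ →
      m₁ = m₂ - α * (M : ℝ) ^ 2 := by
  have hB : 0 ≤ ∑ i, ∑ j, |A i j| := by positivity
  refine ⟨2 * ∑ i, ∑ j, |A i j|, by positivity, ?_⟩
  rintro α hα m₁ m₂ ⟨⟨x, hx, rfl⟩, hmin₁⟩ ⟨⟨y, hy, hyM, rfl⟩, hmin₂⟩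
  have hxy := hmin₁ ⟨y, hy, rfl⟩
  rw [hC, dotProduct_add_penalty_mulVec_of_binary A α M hx] at hxy ⊢
  rw [dotProduct_add_penalty_mulVec_of_binary A α M hy, hyM] at hxy
  obtain ⟨k, hk⟩ := exists_nat_sum_eq_of_binary hx
  by_cases hkM : k = M
  · subst hkM
    have hyx := hmin₂ ⟨x, hx, hk, rfl⟩
    rw [hk] at hxy ⊢
    linarith
  · have hsq := one_le_sq_natCast_sub_natCast hkM
    have hxB := abs_le.mp (abs_dotProduct_mulVec_le_of_binary A hx)
    have hyB := abs_le.mp (abs_dotProduct_mulVec_le_of_binary A hy)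
    have hpen := le_mul_of_one_le_right (by linarith : 0 ≤ α) hsq
    rw [hk] at hxy
    linarith
end
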